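/- arXiv:2006.01975 — 2 statements merged into one kernel-verified Lean document; each statement's English description precedes it below -/
import Mathlib

section
/- Fix n ≥ 1, disjoint sets L, R with |L| = |R| = n, a bijection M : L → R, and ε > 0. Let D, D' ⊆ R × L and suppose G_{D'} is a (1±3ε)-cut sparsifier of G_D. Then for every v ∈ R, writing N_D(v) := {u ∈ L : (v,u) ∈ D} and N_{D'}(v) := {u ∈ L : (v,u) ∈ D'}, one has |N_{D'}(v) ∖ N_D(v)| ≤ 3εn and |N_D(v) ∖ N_{D'}(v)| ≤ 3εn. -/
open Finset

/-- The number of edges of the digraph `G_D` (matching edges `(u, M u)` for `u ∈ L`,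
together with the edges in `D`) going from `S` to its complement. -/
def eCount {V : Type*} [Fintype V] [DecidableEq V]
    (L : Finset V) (M : V → V) (D : Finset (V × V)) (S : Finset V) : ℕ :=
  (Finset.univ.filter
    (fun p : V × V => ((p.1 ∈ L ∧ p.2 = M p.1) ∨ p ∈ D) ∧ p.1 ∈ S ∧ p.2 ∉ S)).card

/-- For `T ⊆ L` and `v ∈ R`, the edges of `G_D` leaving `{v} ∪ (L \ T)` are the matching edges out
of `L \ T` that avoid `v`, together with the edges of `D` from `v` into `T`. -/
theorem eCount_insert_sdiff {V : Type*} [Fintype V] [DecidableEq V]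
    {L R : Finset V} {M : V → V} (hdisj : Disjoint L R) (hM : Set.MapsTo M ↑L ↑R)
    {D : Finset (V × V)} (hD : D ⊆ R ×ˢ L) {T : Finset V} (hT : T ⊆ L) {v : V} (hv : v ∈ R) :
    eCount L M D (insert v (L \ T)) =
      ((L \ T).filter (fun u => M u ≠ v)).card + (T.filter (fun u => (v, u) ∈ D)).card := by
  have hLR : ∀ x ∈ L, x ∉ R := fun x hx hx' => Finset.disjoint_left.mp hdisj hx hx'
  have hMR : ∀ u ∈ L, M u ∈ R := fun u hu => by simpa using hM (by simpa using hu)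
  have hDR : ∀ a b, (a, b) ∈ D → a ∈ R ∧ b ∈ L := fun a b h => by simpa using hD h
  have hmatch : Function.Injective (fun u => (u, M u)) := fun a b h => congrArg Prod.fst h
  have hstar : Function.Injective (fun u : V => (v, u)) := fun a b h => congrArg Prod.snd h
  rw [← Finset.card_image_of_injective _ hmatch, ← Finset.card_image_of_injective _ hstar,
    ← Finset.card_union_of_disjoint]
  · unfold eCount
    congr 1
    ext ⟨a, b⟩
    simp only [mem_filter, mem_univ, true_and, mem_insert, mem_sdiff, mem_union, mem_image,
      Prod.mk.injEq]
    grind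
  · rw [Finset.disjoint_left]
    simp only [mem_image, mem_filter, mem_sdiff]
    grind

/-- If `G_{D'}` is a `(1 ± 3ε)`-cut sparsifier of `G_D`, then for every `v ∈ R` the
out-neighborhoods of `v` in `D` and `D'` differ by at most `3εn` vertices in each
direction. -/
theorem sparsifier_neighborhoods_close {V : Type*} [Fintype V] [DecidableEq V]
    (n : ℕ) (hn : 1 ≤ n) (L R : Finset V) (M : V → V)
    (hdisj : Disjoint L R) (hunion : L ∪ R = Finset.univ)
    (hL : L.card = n) (hR : R.card = n) (hM : Set.BijOn M ↑L ↑R)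
    (ε : ℝ) (hε : 0 < ε)
    (D D' : Finset (V × V)) (hD : D ⊆ R ×ˢ L) (hD' : D' ⊆ R ×ˢ L)
    (hsp : ∀ S : Finset V,
      (1 - 3 * ε) * (eCount L M D S : ℝ) ≤ (eCount L M D' S : ℝ) ∧
      (eCount L M D' S : ℝ) ≤ (1 + 3 * ε) * (eCount L M D S : ℝ)) :
    ∀ v ∈ R,
      (((L.filter (fun u => (v, u) ∈ D')) \ (L.filter (fun u => (v, u) ∈ D))).card : ℝ)
          ≤ 3 * ε * n ∧
      (((L.filter (fun u => (v, u) ∈ D)) \ (L.filter (fun u => (v, u) ∈ D'))).card : ℝ)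
          ≤ 3 * ε * n := by
  intro v hv
  have matching_bound (T : Finset V) (hT : T ⊆ L) :
      (((L \ T).filter (fun u => M u ≠ v)).card : ℝ) + T.card ≤ n := by
    rw [← hL, ← Finset.card_sdiff_add_card_eq_card hT]
    push_cast
    gcongr
    exact Finset.filter_subset _ _
  constructor
  · set T := L.filter (fun u => (v, u) ∈ D') \ L.filter (fun u => (v, u) ∈ D) with hTdef
    have hT : T ⊆ L := sdiff_subset.trans (filter_subset _ _)
    have h := (hsp (insert v (L \ T))).2
    rw [eCount_insert_sdiff hdisj hM.mapsTo hD hT hv,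
      eCount_insert_sdiff hdisj hM.mapsTo hD' hT hv,
      show T.filter (fun u => (v, u) ∈ D) = ∅ from filter_false_of_mem (by simp +contextual [hTdef]),
      show T.filter (fun u => (v, u) ∈ D') = T from filter_true_of_mem (by simp +contextual [hTdef])] at h
    push_cast [Finset.card_empty] at h
    nlinarith [mul_le_mul_of_nonneg_left (matching_bound T hT) hε.le,
      mul_nonneg hε.le (Nat.cast_nonneg (α := ℝ) T.card)]
  · set T := L.filter (fun u => (v, u) ∈ D) \ L.filter (fun u => (v, u) ∈ D') with hTdef
    have hT : T ⊆ L := sdiff_subset.trans (filter_subset _ _)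
    have h := (hsp (insert v (L \ T))).1
    rw [eCount_insert_sdiff hdisj hM.mapsTo hD hT hv,
      eCount_insert_sdiff hdisj hM.mapsTo hD' hT hv,
      show T.filter (fun u => (v, u) ∈ D') = ∅ from filter_false_of_mem (by simp +contextual [hTdef]),
      show T.filter (fun u => (v, u) ∈ D) = T from filter_true_of_mem (by simp +contextual [hTdef])] at h
    push_cast [Finset.card_empty] at h
    nlinarith [mul_le_mul_of_nonneg_left (matching_bound T hT) hε.le]
end

section
/- Let n be even with n ≥ 4, let L and R be disjoint sets with |L| = |R| = n/2, and let M : L → R be a bijection. Let G be the weighted digraph on V = L ∪ R with weight 1 on every matching edge (u, M(u)) for u ∈ L, weight 1 on every pair (v, u) ∈ R × L, and weight 0 elsewhere. Let 0 < ε < 1 and let H be any weighted digraph on V such that H's positive-weight pairs are a subset of G's edges, H has weight exactly 1 on every matching edge (u, M(u)), and H has arbitrary nonnegative weights on pairs in R × L. If some v ∈ R satisfies |{u ∈ L : w_H(v,u) > 0}| < (1−ε)·(n/2 − 1), then H is not a (1±ε) for-all cut sparsifier of G: there exists S ⊆ V with w_H(S,S̄) < (1−ε)·w_G(S,S̄).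 (Indeed, taking T = {u ∈ L : w_H(v,u) > 0} and S = {v} ∪ T, one has w_G(S,S̄) ≥ n/2 − 1 while w_H(S,S̄) ≤ |T|.) -/
open Finset

/-- The value of the directed cut `(S, Sᶜ)` in the weighted digraph `w`. -/
noncomputable def cutW {V : Type*} [Fintype V] [DecidableEq V]
    (w : V × V → ℝ) (S : Finset V) : ℝ :=
  ∑ u ∈ S, ∑ v ∈ Sᶜ, w (u, v)

/-- The weight function of the graph `G`: weight `1` on every matching edge
`(u, M u)` for `u ∈ L` and on every pair in `R × L`, and weight `0` elsewhere. -/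
def wGraphG {V : Type*} [DecidableEq V] (L R : Finset V) (M : V → V)
    (p : V × V) : ℝ :=
  if (p.1 ∈ L ∧ p.2 = M p.1) ∨ (p.1 ∈ R ∧ p.2 ∈ L) then 1 else 0

theorem cutW_insert {V : Type*} [Fintype V] [DecidableEq V] (w : V × V → ℝ)
    {v : V} {T : Finset V} (hv : v ∉ T) :
    cutW w (insert v T) = (∑ y ∈ (insert v T)ᶜ, w (v, y)) +
      ∑ u ∈ T, ∑ y ∈ (insert v T)ᶜ, w (u, y) :=
  Finset.sum_insert hv

theorem wGraphG_nonneg {V : Type*} [DecidableEq V] (L R : Finset V) (M : V → V)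
    (p : V × V) : 0 ≤ wGraphG L R M p := by
  unfold wGraphG
  split_ifs <;> norm_num

/-- The graph `G` has at least `|L| - 1` edges leaving `{v} ∪ T` when `v ∈ R` and `T ⊆ L`. -/
theorem card_sub_one_le_cutW_wGraphG {V : Type*} [Fintype V] [DecidableEq V]
    {L R : Finset V} (hdisj : Disjoint L R) {M : V → V} (hM : Set.BijOn M ↑L ↑R)
    {v : V} (hv : v ∈ R) {T : Finset V} (hT : T ⊆ L) :
    (L.card : ℝ) - 1 ≤ cutW (wGraphG L R M) (insert v T) := by
  have hvL : v ∉ L := fun h => Finset.disjoint_left.mp hdisj h hv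
  rw [cutW_insert _ fun h => hvL (hT h)]
  have from_v : (L.card : ℝ) - T.card ≤ ∑ y ∈ (insert v T)ᶜ, wGraphG L R M (v, y) := by
    have hsub : L \ T ⊆ (insert v T)ᶜ := by
      intro y hy
      simp only [mem_sdiff] at hy
      simp only [mem_compl, mem_insert, not_or]
      exact ⟨fun h => hvL (h ▸ hy.1), hy.2⟩
    calc (L.card : ℝ) - T.card = ∑ y ∈ L \ T, wGraphG L R M (v, y) := by
          have hone : ∀ y ∈ L \ T, wGraphG L R M (v, y) = 1 := fun y hy =>
            if_pos (Or.inr ⟨hv, (mem_sdiff.mp hy).1⟩)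
          rw [Finset.sum_congr rfl hone, Finset.sum_const, nsmul_one,
            Finset.cast_card_sdiff hT]
      _ ≤ _ := Finset.sum_le_sum_of_subset_of_nonneg hsub fun y _ _ => wGraphG_nonneg L R M _
  have from_T : (T.card : ℝ) - 1 ≤ ∑ u ∈ T, ∑ y ∈ (insert v T)ᶜ, wGraphG L R M (u, y) := by
    have hfib : (T.filter fun u => M u = v).card ≤ 1 := by
      rw [Finset.card_le_one]
      intro a ha b hb
      rw [mem_filter] at ha hb
      exact hM.injOn (hT ha.1) (hT hb.1) (ha.2.trans hb.2.symm)
    have hfib' : ((T.filter fun u => M u = v).card : ℝ) ≤ 1 := by exact_mod_cast hfib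
    calc (T.card : ℝ) - 1 ≤ T.card - (T.filter fun u => M u = v).card := by linarith
      _ = ∑ u ∈ T, (1 - if M u = v then (1 : ℝ) else 0) := by
          rw [Finset.sum_sub_distrib, Finset.sum_boole, Finset.sum_const, nsmul_one]
      _ ≤ _ := by
          refine Finset.sum_le_sum fun u hu => ?_
          split_ifs with h
          · simpa using Finset.sum_nonneg fun y _ => wGraphG_nonneg L R M (u, y)
          · have hmem : M u ∈ (insert v T)ᶜ := by
              simp only [mem_compl, mem_insert, not_or]
              exact ⟨h, fun h' => Finset.disjoint_left.mp hdisj (hT h') (hM.mapsTo (hT hu))⟩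
            have hone : wGraphG L R M (u, M u) = 1 := if_pos (Or.inl ⟨hT hu, rfl⟩)
            rw [sub_zero, ← hone]
            exact Finset.single_le_sum (f := fun y => wGraphG L R M (u, y))
              (fun y _ => wGraphG_nonneg L R M _) hmem
  linarith

/-- If `H` is supported on `G` with unit weights on the matching, and `T ⊆ L` contains all
out-neighbours in `L` of `v ∈ R` in `H`, then at most weight `|T|` leaves `{v} ∪ T` in `H`. -/
theorem cutW_insert_le_card {V : Type*} [Fintype V] [DecidableEq V]
    {L R : Finset V} (hdisj : Disjoint L R) {M : V → V} {wH : V × V → ℝ}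
    (hsupp : ∀ p : V × V, 0 < wH p → 0 < wGraphG L R M p)
    (hmatch : ∀ u ∈ L, wH (u, M u) = 1) {v : V} (hv : v ∈ R) {T : Finset V} (hT : T ⊆ L)
    (hTv : ∀ u ∈ L, 0 < wH (v, u) → u ∈ T) :
    cutW wH (insert v T) ≤ T.card := by
  have hvL : v ∉ L := fun h => Finset.disjoint_left.mp hdisj h hv
  have adj_of_pos : ∀ p : V × V, 0 < wH p →
      (p.1 ∈ L ∧ p.2 = M p.1) ∨ (p.1 ∈ R ∧ p.2 ∈ L) := by
    intro p hp
    by_contra h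
    have := hsupp p hp
    rw [wGraphG, if_neg h] at this
    exact lt_irrefl _ this
  rw [cutW_insert _ fun h => hvL (hT h)]
  have from_v : ∑ y ∈ (insert v T)ᶜ, wH (v, y) ≤ 0 := by
    refine Finset.sum_nonpos fun y hy => ?_
    by_contra! h
    simp only [mem_compl, mem_insert, not_or] at hy
    rcases adj_of_pos _ h with h' | h'
    · exact hvL h'.1
    · exact hy.2 (hTv y h'.2 h)
  have from_T : ∑ u ∈ T, ∑ y ∈ (insert v T)ᶜ, wH (u, y) ≤ ∑ _u ∈ T, (1 : ℝ) := by
    refine Finset.sum_le_sum fun u hu => ?_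
    calc ∑ y ∈ (insert v T)ᶜ, wH (u, y)
        ≤ ∑ y ∈ (insert v T)ᶜ, if y = M u then (1 : ℝ) else 0 := by
          refine Finset.sum_le_sum fun y _ => ?_
          split_ifs with h
          · rw [h, hmatch u (hT hu)]
          · by_contra! hpos
            rcases adj_of_pos _ hpos with h' | h'
            · exact h h'.2
            · exact Finset.disjoint_left.mp hdisj (hT hu) h'.1
      _ ≤ 1 := by
          rw [Finset.sum_ite_eq']
          split_ifs <;> norm_num
  rw [Finset.sum_const, nsmul_one] at from_T
  linarith

/-- Refutation of the directed-connectivity sampling conjecture: for the graph `G`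
consisting of a perfect matching `L → R` and a complete bipartite graph `R → L`,
any reweighted subgraph `H` that keeps all matching edges with weight `1` but keeps
fewer than `(1-ε)(n/2 - 1)` of the out-edges of some `v ∈ R` fails to be a `(1 ± ε)`
for-all cut sparsifier of `G`. -/
theorem sampling_by_directed_connectivity_fails {V : Type*} [Fintype V] [DecidableEq V]
    (n : ℕ) (hn4 : 4 ≤ n) (heven : Even n)
    (L R : Finset V) (hdisj : Disjoint L R) (hunion : L ∪ R = Finset.univ)
    (hL : L.card = n / 2) (hR : R.card = n / 2)
    (M : V → V) (hM : Set.BijOn M ↑L ↑R)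
    (ε : ℝ) (hε0 : 0 < ε) (hε1 : ε < 1)
    (wH : V × V → ℝ)
    (hH0 : ∀ p : V × V, 0 ≤ wH p)
    (hsupp : ∀ p : V × V, 0 < wH p → 0 < wGraphG L R M p)
    (hmatch : ∀ u ∈ L, wH (u, M u) = 1)
    (v : V) (hv : v ∈ R)
    (hdeg : ((L.filter (fun u => 0 < wH (v, u))).card : ℝ) < (1 - ε) * ((n : ℝ) / 2 - 1)) :
    ∃ S : Finset V, cutW wH S < (1 - ε) * cutW (wGraphG L R M) S := by
  set T := L.filter (fun u => 0 < wH (v, u))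
  have hT : T ⊆ L := Finset.filter_subset _ _
  refine ⟨insert v T, ?_⟩
  have hcard : (L.card : ℝ) = (n : ℝ) / 2 := by
    rw [hL, Nat.cast_div_charZero heven.two_dvd, Nat.cast_ofNat]
  have hG := card_sub_one_le_cutW_wGraphG hdisj hM hv hT
  rw [hcard] at hG
  calc cutW wH (insert v T) ≤ T.card :=
        cutW_insert_le_card hdisj hsupp hmatch hv hT fun u hu h => mem_filter.mpr ⟨hu, h⟩
    _ < (1 - ε) * ((n : ℝ) / 2 - 1) := hdeg
    _ ≤ _ := mul_le_mul_of_nonneg_left hG (by linarith)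
end
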